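/- Let v ≥ 3 be odd, let F = {C_1, …, C_n} be a (K_v,C_5)-difference system, and let s with 1 ≤ s ≤ n be the number of cycles of F that are of type 1. Then NC(v,5) ≥ ⌈24^s / φ(v)⌉. -/

import Mathlib

namespace CCS

/-- A block: a set of edges of the complete graph on `ZMod v`. -/
abbrev Block (v : ℕ) := Finset (Sym2 (ZMod v))

/-- The edge set of the closed tuple `c = (c 0, c 1, …, c (k-1))`. -/
def edgesOf {v k : ℕ} (c : Fin k → ZMod v) : Block v :=
  Finset.image (fun i : Fin k => s(c i, c ⟨(i.1 + 1) % k, Nat.mod_lt _ i.pos⟩)) Finset.univ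

/-- `E` is the edge set of a `k`-cycle on `ZMod v`. Since for `k ≥ 3` the edge set
determines the closed tuple up to rotation and reversal, a `k`-cycle is identified
with its edge set. -/
def IsCycleBlock (v k : ℕ) (E : Block v) : Prop :=
  ∃ c : Fin k → ZMod v, Function.Injective c ∧ E = edgesOf c

/-- The translate `E + z` of a cycle. -/
def translateBlock {v : ℕ} (E : Block v) (z : ZMod v) : Block v :=
  E.image (Sym2.map (· + z))

/-- A `(K_v, C_k)`-design: a set of `k`-cycles whose edge sets partition the edges of `K_v`. -/
def IsDesign (v k : ℕ) (B : Set (Block v)) : Prop :=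
  (∀ E ∈ B, IsCycleBlock v k E) ∧
  ∀ e : Sym2 (ZMod v), ¬ e.IsDiag → ∃! E, E ∈ B ∧ e ∈ E

/-- A cyclic `(K_v, C_k)`-design. -/
def IsCyclicDesign (v k : ℕ) (B : Set (Block v)) : Prop :=
  IsDesign v k B ∧ ∀ E ∈ B, ∀ z : ZMod v, translateBlock E z ∈ B

/-- Two designs are isomorphic if a bijection of `ZMod v` maps one onto the other. -/
def Isomorphic {v : ℕ} (B B' : Set (Block v)) : Prop :=
  ∃ f : ZMod v ≃ ZMod v, B' = (fun E : Block v => E.image (Sym2.map f)) '' B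

/-- `NC v k`: the number of cyclic `(K_v, C_k)`-designs up to isomorphism. -/
noncomputable def NC (v k : ℕ) : ℕ :=
  Nat.card (Quot fun B B' : {B : Set (Block v) // IsCyclicDesign v k B} =>
    Isomorphic B.1 B'.1)

/-- The type of a cycle: the order of its stabilizer under translations. -/
noncomputable def cycleType {v : ℕ} (E : Block v) : ℕ :=
  Nat.card {z : ZMod v // translateBlock E z = E}

/-- The two differences `±(a-b)` arising from an edge `{a,b}`. -/
def edgeDiffs {v : ℕ} : Sym2 (ZMod v) → Multiset (ZMod v) :=
  Sym2.lift ⟨fun a b => {a - b, b - a}, fun a b => by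
    show (a-b) ::ₘ {b-a} = (b-a) ::ₘ {a-b}; exact Multiset.cons_swap _ _ _⟩

/-- The multiset of the `2k` differences arising from the `k` edges of a cycle.
For a cycle of type `d` this is `d` copies of the list `∂C` of partial differences. -/
def fullDiffs {v : ℕ} (E : Block v) : Multiset (ZMod v) :=
  E.val.bind edgeDiffs

/-- The multiset `∂C` of partial differences of a cycle: each difference is counted
with multiplicity equal to its multiplicity among the `2k` edge differences divided
by the type of the cycle. -/
noncomputable def partialDiffs {v : ℕ} (E : Block v) : Multiset (ZMod v) :=
  (fullDiffs E).toFinset.val.bind fun x =>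
    Multiset.replicate ((fullDiffs E).count x / cycleType E) x

/-- A `(K_v, C_k)`-difference system: a set of `k`-cycles whose partial differences
cover every nonzero element of `ZMod v` exactly once. -/
def IsDifferenceSystem (v k : ℕ) (F : Finset (Block v)) : Prop :=
  (∀ E ∈ F, IsCycleBlock v k E) ∧
  ∀ x : ZMod v, (F.val.bind partialDiffs).count x = if x = 0 then 0 else 1

end CCS

namespace CCS

section Isomorphism

open Equiv

variable {v k : ℕ}

/-- The image of a set of blocks under a permutation of the vertices. -/
def mapBlocks (f : Perm (ZMod v)) (B : Set (Block v)) : Set (Block v) :=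
  (fun E : Block v => E.image (Sym2.map f)) '' B

lemma mapBlocks_mul (f g : Perm (ZMod v)) (B : Set (Block v)) :
    mapBlocks (f * g) B = mapBlocks f (mapBlocks g B) := by
  simp only [mapBlocks, Set.image_image, Finset.image_image, Perm.coe_mul, Sym2.map_comp]

lemma mapBlocks_one (B : Set (Block v)) : mapBlocks 1 B = B := by
  simp [mapBlocks]

lemma isomorphic_iff {B B' : Set (Block v)} :
    Isomorphic B B' ↔ ∃ f : Perm (ZMod v), mapBlocks f B = B' :=
  ⟨fun ⟨f, h⟩ => ⟨f, h.symm⟩, fun ⟨f, h⟩ => ⟨f, h.symm⟩⟩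

lemma isomorphic_equivalence : Equivalence (Isomorphic (v := v)) := by
  simp only [funext fun B => funext fun B' => propext (isomorphic_iff (v := v) (B := B) (B' := B'))]
  refine ⟨fun B => ⟨1, mapBlocks_one B⟩, ?_, ?_⟩
  · rintro B _ ⟨f, rfl⟩
    exact ⟨f⁻¹, by rw [← mapBlocks_mul, inv_mul_cancel, mapBlocks_one]⟩
  · rintro B _ _ ⟨f, rfl⟩ ⟨g, rfl⟩
    exact ⟨g * f, mapBlocks_mul g f B⟩

lemma mapBlocks_addRight {B : Set (Block v)} (hB : IsCyclicDesign v k B) (z : ZMod v) :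
    mapBlocks (Equiv.addRight z) B = B := by
  have sub : ∀ z : ZMod v, mapBlocks (Equiv.addRight z) B ⊆ B := by
    rintro z _ ⟨E, hE, rfl⟩
    exact hB.2 E hE z
  refine (sub z).antisymm ?_
  have h : mapBlocks (Equiv.addRight z) (mapBlocks (Equiv.addRight (-z)) B) = B := by
    have hz : Equiv.addRight z * Equiv.addRight (-z) = (1 : Perm (ZMod v)) := by ext x; simp
    rw [← mapBlocks_mul, hz, mapBlocks_one]
  conv_lhs => rw [← h]
  exact Set.image_mono (sub (-z))

lemma exists_mapBlocks_fix_zero {B B' : Set (Block v)} (hB' : IsCyclicDesign v k B')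
    (h : Isomorphic B B') : ∃ f : Perm (ZMod v), f 0 = 0 ∧ mapBlocks f B = B' := by
  obtain ⟨f, hf⟩ := isomorphic_iff.1 h
  refine ⟨Equiv.addRight (-f 0) * f, by simp, ?_⟩
  rw [mapBlocks_mul, hf, mapBlocks_addRight hB']

/-- A permutation conjugating a fixed permutation to `x ↦ x + 1` is determined by its value
at one point. -/
lemma perm_eq_of_conj_eq [NeZero v] {f g : Perm (ZMod v)} (hf : f 0 = 0) (hg : g 0 = 0)
    (h : f⁻¹ * Equiv.addRight 1 * f = g⁻¹ * Equiv.addRight 1 * g) : f = g := by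
  have key : ∀ (f : Perm (ZMod v)), f 0 = 0 → ∀ n : ℕ,
      f⁻¹ n = ((f⁻¹ * Equiv.addRight 1 * f) ^ n : Perm (ZMod v)) 0 := by
    intro f hf n
    induction n with
    | zero => rw [Perm.inv_eq_iff_eq]; simp [hf]
    | succ n ih =>
      rw [pow_succ', Perm.mul_apply, ← ih]
      simp
  apply inv_injective
  ext x
  rw [← ZMod.natCast_zmod_val x, key f hf, key g hg, h]

/-- An isomorphism class of cyclic designs contains at most `v - 1` cyclic designs. -/
lemma card_isomorphic_le [Fact (1 < v)] (D : {B : Set (Block v) // IsCyclicDesign v k B}) :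
    Nat.card {D' : {B : Set (Block v) // IsCyclicDesign v k B} // Isomorphic D.1 D'.1} ≤ v - 1 := by
  have : NeZero v := ⟨by have := Fact.out (p := 1 < v); omega⟩
  let X := {D' : {B : Set (Block v) // IsCyclicDesign v k B} // Isomorphic D.1 D'.1}
  let G := {g : Perm (ZMod v) // g 0 = 0 ∧ mapBlocks g D.1 = D.1}
  have hne : Nonempty G := ⟨1, by simp, mapBlocks_one _⟩
  choose f hf0 hf using fun D' : X => exists_mapBlocks_fix_zero D'.1.2 D'.2
  let e : X × G → Perm (ZMod v) := fun p =>
    (f p.1 * p.2.1)⁻¹ * Equiv.addRight 1 * (f p.1 * p.2.1)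
  have hfg0 : ∀ p : X × G, (f p.1 * p.2.1) 0 = 0 := fun p => by
    rw [Perm.mul_apply, p.2.2.1, hf0]
  have hfg : ∀ p : X × G, mapBlocks (f p.1 * p.2.1) D.1 = p.1.1.1 := fun p => by
    rw [mapBlocks_mul, p.2.2.2, hf]
  have he0 : ∀ p, e p 0 ≠ 0 := by
    intro p h
    have h' : (f p.1 * p.2.1)⁻¹ ((f p.1 * p.2.1) 0 + 1) = 0 := h
    rw [Perm.inv_eq_iff_eq, hfg0 p] at h'
    simp at h'
  have he : ∀ p, mapBlocks (e p) D.1 = D.1 := by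
    intro p
    simp only [e]
    rw [mapBlocks_mul, mapBlocks_mul, hfg, mapBlocks_addRight p.1.1.2, ← hfg p, ← mapBlocks_mul,
      inv_mul_cancel, mapBlocks_one]
  let Φ : X × G → {z : ZMod v // z ≠ 0} × G := fun p =>
    (⟨e p 0, he0 p⟩, ⟨Equiv.addRight (-(e p 0)) * e p, by simp, by
      rw [mapBlocks_mul, he, mapBlocks_addRight D.2]⟩)
  have hΦ : Function.Injective Φ := by
    intro p q h
    have h1 : e p 0 = e q 0 := congrArg (fun r => r.1.1) h
    have h2 : Equiv.addRight (-(e p 0)) * e p = Equiv.addRight (-(e q 0)) * e q :=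
      congrArg (fun r => r.2.1) h
    rw [h1] at h2
    have h3 := perm_eq_of_conj_eq (hfg0 p) (hfg0 q) (mul_left_cancel h2)
    have h4 : p.1 = q.1 := Subtype.ext (Subtype.ext (by rw [← hfg p, ← hfg q, h3]))
    rw [h4] at h3
    exact Prod.ext h4 (Subtype.ext (mul_left_cancel h3))
  have hcard := Nat.card_le_card_of_injective Φ hΦ
  rw [Nat.card_prod, Nat.card_prod] at hcard
  have hz : Nat.card {z : ZMod v // z ≠ 0} = v - 1 := by
    rw [Nat.card_eq_fintype_card, Fintype.card_subtype_compl, ZMod.card]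
    simp
  rw [hz] at hcard
  exact Nat.le_of_mul_le_mul_right hcard Nat.card_pos

/-- Comparing the number of cyclic designs with the number of isomorphism classes. -/
lemma card_cyclicDesign_le [Fact (1 < v)] :
    Nat.card {B : Set (Block v) // IsCyclicDesign v k B} ≤ NC v k * (v - 1) := by
  have : NeZero v := ⟨by have := Fact.out (p := 1 < v); omega⟩
  let C := {B : Set (Block v) // IsCyclicDesign v k B}
  let r : C → C → Prop := fun B B' => Isomorphic B.1 B'.1
  have hr : Equivalence r := isomorphic_equivalence.comap Subtype.val
  have fin : Finite C := inferInstance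
  have e : C ≃ Σ q : Quot r, {D : C // Quot.mk r D = q} := (Equiv.sigmaFiberEquiv _).symm
  have := Fintype.ofFinite (Quot r)
  change Nat.card C ≤ Nat.card (Quot r) * (v - 1)
  rw [Nat.card_congr e, Nat.card_sigma, Nat.card_eq_fintype_card, ← smul_eq_mul,
    ← Finset.card_univ]
  refine Finset.sum_le_card_nsmul _ _ _ fun q _ => ?_
  induction q using Quot.ind with
  | mk D =>
    refine le_of_eq_of_le ?_ (card_isomorphic_le D)
    refine Nat.card_congr (Equiv.subtypeEquivRight fun D' => ?_)
    rw [hr.quot_mk_eq_iff]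
    exact ⟨hr.symm, hr.symm⟩

end Isomorphism

section DifferenceSystem

variable {v : ℕ}

lemma mem_edgesOf_five {c : Fin 5 → ZMod v} {e : Sym2 (ZMod v)} :
    e ∈ edgesOf c ↔ ∃ i : Fin 5, e = s(c i, c (i + 1)) := by
  simp only [edgesOf, Finset.mem_image, Finset.mem_univ, true_and]
  refine exists_congr fun i => ?_
  rw [eq_comm]
  have : (⟨(i.1 + 1) % 5, Nat.mod_lt _ i.pos⟩ : Fin 5) = i + 1 := by
    ext; simp [Fin.val_add]
  rw [this]

lemma card_edgesOf_five {c : Fin 5 → ZMod v} (hc : Function.Injective c) :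
    (edgesOf c).card = 5 := by
  rw [edgesOf, Finset.card_image_of_injective _ ?_, Finset.card_univ, Fintype.card_fin]
  intro i j h
  simp only [Sym2.eq_iff, hc.eq_iff] at h
  revert h
  revert i j
  decide

lemma card_edgeDiffs (e : Sym2 (ZMod v)) : (edgeDiffs e).card = 2 := by
  induction e using Sym2.ind with
  | _ a b => rfl

lemma card_fullDiffs {E : Block v} (hE : IsCycleBlock v 5 E) : (fullDiffs E).card = 10 := by
  obtain ⟨c, hc, rfl⟩ := hE
  have : (edgesOf c).val.card = 5 := card_edgesOf_five hc
  simp [fullDiffs, Multiset.card_bind, card_edgeDiffs, this]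

lemma partialDiffs_of_type_one {E : Block v} (h : cycleType E = 1) :
    partialDiffs E = fullDiffs E := by
  ext x
  simp only [partialDiffs, h, Nat.div_one, Multiset.count_bind, Multiset.count_replicate]
  change ∑ y ∈ (fullDiffs E).toFinset, _ = _
  rw [Finset.sum_ite_eq']
  split_ifs with hx
  · rfl
  · exact (Multiset.count_eq_zero.2 (by simpa using hx)).symm

lemma mem_fullDiffs_of_mem_partialDiffs {E : Block v} {x : ZMod v} (h : x ∈ partialDiffs E) :
    x ∈ fullDiffs E := by
  simp only [partialDiffs, Multiset.mem_bind, Multiset.mem_replicate] at h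
  obtain ⟨y, hy, -, rfl⟩ := h
  simpa using hy

/-- The vertices of a cycle that is stable under translation by `z ≠ 0` form a coset of the
subgroup generated by `z`, which has order `5`. -/
lemma differences_of_translate_eq {c : Fin 5 → ZMod v} (hc : Function.Injective c) {z : ZMod v}
    (hz : z ≠ 0) (h : translateBlock (edgesOf c) z = edgesOf c) :
    5 • z = 0 ∧ ∀ i j, 5 • (c i - c j) = 0 := by
  classical
  let V := Finset.univ.image c
  have hV : V.card = 5 := by
    rw [Finset.card_image_of_injective _ hc, Finset.card_univ, Fintype.card_fin]
  have hmem : ∀ x, x ∈ V ↔ ∃ e ∈ edgesOf c, x ∈ e := by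
    intro x
    constructor
    · intro hx
      obtain ⟨i, -, rfl⟩ := Finset.mem_image.1 hx
      exact ⟨_, mem_edgesOf_five.2 ⟨i, rfl⟩, Sym2.mem_mk_left _ _⟩
    · rintro ⟨e, he, hx⟩
      obtain ⟨i, rfl⟩ := mem_edgesOf_five.1 he
      rcases Sym2.mem_iff.1 hx with rfl | rfl <;> simp [V]
  have hVz : ∀ x ∈ V, x + z ∈ V := by
    intro x hx
    obtain ⟨e, he, hxe⟩ := (hmem x).1 hx
    refine (hmem _).2 ⟨Sym2.map (· + z) e, ?_, Sym2.mem_map.2 ⟨x, hxe, rfl⟩⟩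
    rw [← h]
    exact Finset.mem_image_of_mem _ he
  have himg : V.image (· + z) = V :=
    Finset.eq_of_subset_of_card_le (Finset.image_subset_iff.2 hVz)
      (Finset.card_image_of_injective _ (add_left_injective z)).ge
  have h5z : 5 • z = 0 := by
    have := Finset.sum_image (s := V) (f := fun x => x) (add_left_injective z).injOn
    rw [himg, Finset.sum_add_distrib, Finset.sum_const, hV] at this
    simpa using this
  refine ⟨h5z, ?_⟩
  have : Fact (Nat.Prime 5) := ⟨Nat.prime_five⟩
  have hord : addOrderOf z = 5 := addOrderOf_eq_prime h5z hz
  have key : ∀ x ∈ V, V = (Finset.range 5).image fun n => x + n • z := by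
    intro x hx
    symm
    apply Finset.eq_of_subset_of_card_le
    · have : ∀ n : ℕ, x + n • z ∈ V := by
        intro n
        induction n with
        | zero => simpa using hx
        | succ n ih =>
          rw [succ_nsmul, ← add_assoc]
          exact hVz _ ih
      exact Finset.image_subset_iff.2 fun n _ => this n
    · rw [hV, Finset.card_image_of_injOn, Finset.card_range]
      intro n hn m hm hnm
      have := nsmul_injOn_Iio_addOrderOf (x := z)
      rw [hord] at this
      exact this (by simpa using hn) (by simpa using hm) (add_left_cancel hnm)
  intro i j
  have hi : c i ∈ V := by simp [V]
  rw [key (c j) (by simp [V])] at hi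
  obtain ⟨n, -, hn⟩ := Finset.mem_image.1 hi
  rw [← hn, add_sub_cancel_left, nsmul_left_comm, h5z, smul_zero]

lemma nsmul_eq_zero_of_mem_fullDiffs [NeZero v] {E : Block v} (hE : IsCycleBlock v 5 E)
    (h : cycleType E ≠ 1) {x : ZMod v} (hx : x ∈ fullDiffs E) : 5 ∣ v ∧ 5 • x = 0 := by
  obtain ⟨c, hc, rfl⟩ := hE
  obtain ⟨z, hz0, hz⟩ : ∃ z : ZMod v, z ≠ 0 ∧ translateBlock (edgesOf c) z = edgesOf c := by
    by_contra! hcon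
    apply h
    rw [cycleType, Nat.card_eq_one_iff_unique]
    have h0 : translateBlock (edgesOf c) 0 = edgesOf c := by simp [translateBlock]
    refine ⟨⟨fun a b => Subtype.ext ?_⟩, ⟨⟨0, h0⟩⟩⟩
    rw [not_imp_not.1 (hcon a.1) a.2, not_imp_not.1 (hcon b.1) b.2]
  obtain ⟨h5, hd⟩ := differences_of_translate_eq hc hz0 hz
  refine ⟨?_, ?_⟩
  · have : Fact (Nat.Prime 5) := ⟨Nat.prime_five⟩
    rw [← addOrderOf_eq_prime h5 hz0]
    simpa using addOrderOf_dvd_card (x := z)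
  · simp only [fullDiffs, Multiset.mem_bind, Finset.mem_val] at hx
    obtain ⟨e, he, hx⟩ := hx
    obtain ⟨i, rfl⟩ := mem_edgesOf_five.1 he
    have hx : x = c i - c (i + 1) ∨ x = c (i + 1) - c i := by simpa [edgeDiffs] using hx
    rcases hx with rfl | rfl <;> exact hd _ _

/-- A difference system with `s` cycles of trivial stabilizer exists only for `v = 10 s + 1` and
`v = 10 s + 5`. -/
lemma order_of_differenceSystem (hv : 3 ≤ v) (hvodd : Odd v) {F : Finset (Block v)}
    (hF : IsDifferenceSystem v 5 F) :
    v = 10 * (F.filter fun E => cycleType E = 1).card + 1 ∨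
      v = 10 * (F.filter fun E => cycleType E = 1).card + 5 := by
  classical
  have : NeZero v := ⟨by omega⟩
  set s := (F.filter fun E => cycleType E = 1).card with hs
  let R := (F.filter fun E => ¬ cycleType E = 1).val.bind partialDiffs
  let P := (F.filter fun E => cycleType E = 1).val.bind partialDiffs
  have hsplit : F.val.bind partialDiffs = P + R := by
    simp only [P, R, ← Multiset.add_bind, Finset.filter_val, Multiset.filter_add_not]
  have hnodup : (P + R).Nodup := by
    rw [← hsplit, Multiset.nodup_iff_count_le_one]
    intro x
    rw [hF.2]
    split_ifs <;> simp
  have hfin : (P + R).toFinset = Finset.univ.erase 0 := by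
    ext x
    rw [← hsplit, Multiset.mem_toFinset, ← Multiset.count_pos, hF.2]
    by_cases hx : x = 0 <;> simp [hx]
  have htotal : P.card + R.card = v - 1 := by
    rw [← Multiset.card_add, ← Multiset.toFinset_card_of_nodup hnodup, hfin,
      Finset.card_erase_of_mem (Finset.mem_univ _), Finset.card_univ, ZMod.card]
  have hP : P.card = 10 * s := by
    simp only [P, Multiset.card_bind]
    change ∑ E ∈ F.filter fun E => cycleType E = 1, (partialDiffs E).card = _
    rw [Finset.sum_congr rfl fun E hE => ?_, Finset.sum_const, smul_eq_mul, mul_comm]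
    rw [Finset.mem_filter] at hE
    rw [partialDiffs_of_type_one hE.2, card_fullDiffs (hF.1 E hE.1)]
  have hR : ∀ x ∈ R, 5 ∣ v ∧ 5 • x = 0 := by
    intro x hx
    simp only [R, Multiset.mem_bind, Finset.mem_val, Finset.mem_filter] at hx
    obtain ⟨E, ⟨hE, hE1⟩, hx⟩ := hx
    exact nsmul_eq_zero_of_mem_fullDiffs (hF.1 E hE) hE1 (mem_fullDiffs_of_mem_partialDiffs hx)
  have hR4 : R.card ≤ 4 := by
    have hRn : R.Nodup := (Multiset.nodup_add.1 hnodup).2.1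
    have h0 : (0 : ZMod v) ∉ R := by
      intro h
      have : (0 : ZMod v) ∈ (P + R).toFinset := by simp [h]
      simp [hfin] at this
    have h5 := IsAddCyclic.card_nsmul_eq_zero_le (α := ZMod v) (n := 5) (by norm_num)
    have : (insert 0 R.toFinset).card ≤ 5 := by
      refine (Finset.card_le_card ?_).trans h5
      intro x hx
      rcases Finset.mem_insert.1 hx with rfl | hx
      · simp
      · simpa using (hR x (by simpa using hx)).2
    rw [Finset.card_insert_of_notMem (by simpa using h0), Multiset.toFinset_card_of_nodup hRn]
      at this
    omega
  obtain ⟨m, hm⟩ := hvodd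
  rcases Multiset.empty_or_exists_mem R with h | ⟨x, hx⟩
  · rw [h] at htotal
    simp at htotal
    omega
  · have := (hR x hx).1
    omega

end DifferenceSystem

section Construction

variable {v : ℕ}

lemma translateBlock_edgesOf {k : ℕ} (c : Fin k → ZMod v) (z : ZMod v) :
    translateBlock (edgesOf c) z = edgesOf (fun i => c i + z) := by
  simp only [translateBlock, edgesOf, Finset.image_image]
  rfl

/-- The closed walk starting at `0` with prescribed steps. -/
def walk (w : Fin 5 → ZMod v) : Fin 5 → ZMod v :=
  ![0, w 0, w 0 + w 1, w 0 + w 1 + w 2, w 0 + w 1 + w 2 + w 3]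

lemma walk_add_one {w : Fin 5 → ZMod v} (hw : ∑ j, w j = 0) (i : Fin 5) :
    walk w (i + 1) = walk w i + w i := by
  rw [Fin.sum_univ_five] at hw
  fin_cases i <;> simp [walk]
  exact hw.symm

lemma walk_injective {w : Fin 5 → ZMod v} (hw : ∑ j, w j = 0) (h0 : ∀ i, w i ≠ 0)
    (h1 : ∀ i j, i ≠ j → w i + w j ≠ 0) : Function.Injective (walk w) := by
  rw [Fin.sum_univ_five] at hw
  have key : ∀ i j : Fin 5, i < j → walk w i ≠ walk w j := by
    intro i j hij h
    fin_cases i <;> fin_cases j <;> simp [walk] at hij h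
    · exact h0 0 h.symm
    · exact h1 0 1 (by decide) h.symm
    · exact h1 3 4 (by decide) (by linear_combination hw + h)
    · exact h0 4 (by linear_combination hw + h)
    · exact h0 1 h
    · exact h1 1 2 (by decide) (by linear_combination -h)
    · exact h1 0 4 (by decide) (by linear_combination hw + h)
    · exact h0 2 h
    · exact h1 2 3 (by decide) (by linear_combination -h)
    · exact h0 3 h
  intro i j h
  rcases lt_trichotomy i j with hij | hij | hij
  · exact absurd h (key i j hij)
  · exact hij
  · exact absurd h.symm (key j i hij)

/-- A family of ring elements together with their negatives. -/
def signed {α : Type*} (w : α → ZMod v) (p : α × Bool) : ZMod v :=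
  if p.2 then w p.1 else -w p.1

/-- Rows of five differences with sum zero which, together with their negatives, cover exactly
once all nonzero elements outside `K`. -/
structure IsDifferenceArray {ι : Type*} (K : Set (ZMod v)) (w : ι × Fin 5 → ZMod v) : Prop where
  sum_eq_zero : ∀ i, ∑ j, w (i, j) = 0
  signed_injective : Function.Injective (signed w)
  range_signed : Set.range (signed w) = {x | x ≠ 0 ∧ x ∉ K}

/-- A translation invariant system of 5-cycles covering exactly once the edges with
difference in `K`. -/
structure IsShortSystem (K : Set (ZMod v)) (S : Set (Block v)) : Prop where
  isCycleBlock : ∀ E ∈ S, IsCycleBlock v 5 E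
  translate_mem : ∀ E ∈ S, ∀ z, translateBlock E z ∈ S
  sub_mem : ∀ E ∈ S, ∀ a b, s(a, b) ∈ E → b - a ∈ K
  existsUnique : ∀ a b, b - a ∈ K → ∃! E, E ∈ S ∧ s(a, b) ∈ E

/-- The translates of the closed walks with steps the rows of `w`, together with `S`. -/
def designOf {ι : Type*} (w : ι × Fin 5 → ZMod v) (S : Set (Block v)) : Set (Block v) :=
  {E | ∃ i z, E = edgesOf fun j => walk (fun j => w (i, j)) j + z} ∪ S

variable {ι : Type*} {K : Set (ZMod v)} {w : ι × Fin 5 → ZMod v} {S : Set (Block v)}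

lemma IsDifferenceArray.ne_zero (hw : IsDifferenceArray K w) (p : ι × Fin 5) : w p ≠ 0 := by
  intro h
  have := @hw.signed_injective (p, true) (p, false) (by simp [signed, h])
  simp at this

lemma IsDifferenceArray.walk_injective (hw : IsDifferenceArray K w) (i : ι) :
    Function.Injective (walk fun j => w (i, j)) := by
  refine CCS.walk_injective (hw.sum_eq_zero i) (fun j => hw.ne_zero _) fun j k hjk h => ?_
  have := @hw.signed_injective ((i, j), true) ((i, k), false)
    (by simpa [signed] using eq_neg_of_add_eq_zero_left h)
  simp at this

lemma mem_edgesOf_walk {w : Fin 5 → ZMod v} (hw : ∑ j, w j = 0) {a b z : ZMod v} :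
    s(a, b) ∈ edgesOf (fun j => walk w j + z) ↔
      ∃ p : Fin 5 × Bool, b - a = signed w p ∧ z = (if p.2 then a else b) - walk w p.1 := by
  simp only [mem_edgesOf_five, Prod.exists, Bool.exists_bool, signed, walk_add_one hw,
    Sym2.eq_iff, if_true, if_false, Bool.false_eq_true]
  refine exists_congr fun j => ?_
  rw [or_comm]
  refine or_congr ⟨?_, ?_⟩ ⟨?_, ?_⟩
  all_goals
    rintro ⟨h1, h2⟩
    constructor
  · rw [h1, h2]; ring
  · rw [h2]; ring
  · rw [h2]; linear_combination -h1
  · rw [h2]; ring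
  · rw [h1, h2]; ring
  · rw [h1]; ring
  · rw [h2]; ring
  · rw [h2]; linear_combination h1

lemma IsDifferenceArray.isCyclicDesign (hw : IsDifferenceArray K w) (hS : IsShortSystem K S) :
    IsCyclicDesign v 5 (designOf w S) := by
  refine ⟨⟨?_, ?_⟩, ?_⟩
  · rintro E (⟨i, z, rfl⟩ | hE)
    · exact ⟨_, (add_left_injective z).comp (hw.walk_injective i), rfl⟩
    · exact hS.isCycleBlock E hE
  · intro e
    induction e using Sym2.ind with
    | _ a b =>
    intro hab
    have hab : b - a ≠ 0 := fun h => hab (by simpa using (sub_eq_zero.1 h).symm)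
    by_cases hK : b - a ∈ K
    · obtain ⟨E, ⟨hE, he⟩, huniq⟩ := hS.existsUnique a b hK
      refine ⟨E, ⟨Or.inr hE, he⟩, ?_⟩
      rintro E' ⟨⟨i, z, rfl⟩ | hE', he'⟩
      · obtain ⟨p, hp, -⟩ := (mem_edgesOf_walk (hw.sum_eq_zero i)).1 he'
        have : b - a ∈ {x | x ≠ 0 ∧ x ∉ K} := hw.range_signed ▸ ⟨((i, p.1), p.2), hp.symm⟩
        exact absurd hK this.2
      · exact huniq E' ⟨hE', he'⟩
    · have : b - a ∈ Set.range (signed w) := hw.range_signed ▸ ⟨hab, hK⟩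
      obtain ⟨⟨⟨i, j⟩, t⟩, h⟩ := this
      refine ⟨_, ⟨Or.inl ⟨i, (if t then a else b) - walk (fun j => w (i, j)) j, rfl⟩,
        (mem_edgesOf_walk (hw.sum_eq_zero i)).2 ⟨(j, t), h.symm, rfl⟩⟩, ?_⟩
      rintro E' ⟨⟨i', z', rfl⟩ | hE', he'⟩
      · obtain ⟨⟨j', t'⟩, hp, hz⟩ := (mem_edgesOf_walk (hw.sum_eq_zero i')).1 he'
        have := @hw.signed_injective ((i', j'), t') ((i, j), t) (hp.symm.trans h.symm)
        simp only [Prod.mk.injEq] at this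
        obtain ⟨⟨rfl, rfl⟩, rfl⟩ := this
        rw [hz]
      · exact absurd (hS.sub_mem E' hE' a b he') hK
  · rintro E (⟨i, z, rfl⟩ | hE) y
    · refine Or.inl ⟨i, z + y, ?_⟩
      rw [translateBlock_edgesOf]
      simp only [add_assoc]
    · exact Or.inr (hS.translate_mem E hE y)

/-- A 5-cycle is determined as a closed tuple by its edges and its first two vertices. -/
lemma eq_of_edgesOf_eq {c d : Fin 5 → ZMod v} (hc : Function.Injective c)
    (hd : Function.Injective d) (h : edgesOf c = edgesOf d) (h0 : c 0 = d 0) (h1 : c 1 = d 1) :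
    c = d := by
  have step : ∀ i : Fin 5, c i = d i → c (i + 1) = d (i + 1) → c (i + 1 + 1) = d (i + 1 + 1) := by
    intro i hi hi1
    have hm : s(c (i + 1), c (i + 1 + 1)) ∈ edgesOf d := h ▸ mem_edgesOf_five.2 ⟨i + 1, rfl⟩
    obtain ⟨j, hj⟩ := mem_edgesOf_five.1 hm
    rcases Sym2.eq_iff.1 hj with ⟨h2, h3⟩ | ⟨h2, h3⟩
    · rw [hi1] at h2
      rw [h3, hd h2]
    · rw [hi1] at h2
      have : i = j := add_right_cancel (hd h2)
      rw [← this, ← hi] at h3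
      have hne : ∀ i : Fin 5, i + 1 + 1 ≠ i := by decide
      exact absurd (hc h3) (hne i)
  have h2 := step 0 h0 h1
  have h3 := step 1 h1 h2
  have h4 := step 2 h2 h3
  funext i
  fin_cases i
  exacts [h0, h1, h2, h3, h4]

lemma row_eq_of_designOf_eq {w' : ι × Fin 5 → ZMod v} (hw : IsDifferenceArray K w)
    (hw' : IsDifferenceArray K w') (hS : IsShortSystem K S)
    (h0 : ∀ i, w (i, 0) = w' (i, 0)) (h : designOf w S = designOf w' S) : w = w' := by
  funext ⟨i, j⟩
  have mem : ∀ {w : ι × Fin 5 → ZMod v}, edgesOf (walk fun j => w (i, j)) ∈ designOf w S :=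
    Or.inl ⟨i, 0, by simp⟩
  have edge : ∀ {w : ι × Fin 5 → ZMod v}, s(0, w (i, 0)) ∈ edgesOf (walk fun j => w (i, j)) :=
    mem_edgesOf_five.2 ⟨0, by simp [walk]⟩
  obtain ⟨E, -, hE⟩ := (hw.isCyclicDesign hS).1.2 s(0, w (i, 0)) (by
    rw [Sym2.mk_isDiag_iff]
    exact (hw.ne_zero _).symm)
  have heq : edgesOf (walk fun j => w (i, j)) = edgesOf (walk fun j => w' (i, j)) :=
    (hE _ ⟨mem, edge⟩).trans (hE _ ⟨h ▸ mem, h0 i ▸ edge⟩).symm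
  have := eq_of_edgesOf_eq (hw.walk_injective i) (hw'.walk_injective i) heq (by simp [walk])
    (by simpa [walk] using h0 i)
  have e := walk_add_one (hw.sum_eq_zero i) j
  rw [this, walk_add_one (hw'.sum_eq_zero i) j] at e
  exact (add_left_cancel e).symm

end Construction

section Mixing

open Equiv

variable {v : ℕ} {ι : Type*}

/-- Permute the entries of each row, and then the last two columns by a permutation of
the rows. -/
def mix (σ : Perm ι) (π : ι → Perm (Fin 5)) : Perm (ι × Fin 5) :=
  (prodShear (Equiv.refl ι) π).trans <|
    ((prodComm ι (Fin 5)).trans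
      (prodShear (Equiv.refl (Fin 5)) fun j => if 3 ≤ j then σ else 1)).trans
      (prodComm (Fin 5) ι)

lemma mix_apply (σ : Perm ι) (π : ι → Perm (Fin 5)) (i : ι) (j : Fin 5) :
    mix σ π (i, j) = (if 3 ≤ π i j then σ i else i, π i j) := by
  simp only [mix, trans_apply, prodShear_apply, prodComm_apply, Prod.swap, coe_refl, id]
  split_ifs <;> rfl

lemma mix_inj {σ σ' : Perm ι} {π π' : ι → Perm (Fin 5)} (h : mix σ π = mix σ' π') :
    σ = σ' ∧ π = π' := by
  have h' : ∀ i j, mix σ π (i, j) = mix σ' π' (i, j) := fun i j => by rw [h]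
  simp only [mix_apply, Prod.mk.injEq] at h'
  have hπ : π = π' := funext fun i => Equiv.ext fun j => (h' i j).2
  refine ⟨Equiv.ext fun i => ?_, hπ⟩
  subst hπ
  simpa using (h' i ((π i)⁻¹ 3)).1

/-- Differences which, together with their negatives, cover exactly once all nonzero elements
outside `K`. -/
structure IsBaseArray (K : Set (ZMod v)) (b : ι × Fin 5 → ZMod v) : Prop where
  signed_injective : Function.Injective (signed b)
  range_signed : Set.range (signed b) = {x | x ≠ 0 ∧ x ∉ K}

variable {K : Set (ZMod v)} {b : ι × Fin 5 → ZMod v} {S : Set (Block v)}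

lemma IsBaseArray.isDifferenceArray_mix (hb : IsBaseArray K b) {σ : Perm ι}
    (hσ : ∀ i, b (i, 0) + b (i, 1) + b (i, 2) + b (σ i, 3) + b (σ i, 4) = 0)
    (π : ι → Perm (Fin 5)) : IsDifferenceArray K (b ∘ mix σ π) := by
  have key : signed (b ∘ mix σ π) = signed b ∘ (prodCongr (mix σ π) (Equiv.refl Bool)) := by
    funext p
    rfl
  refine ⟨fun i => ?_, ?_, ?_⟩
  · simp only [Function.comp, mix_apply]
    rw [Equiv.sum_comp (π i) fun j => b (if 3 ≤ j then σ i else i, j), Fin.sum_univ_five]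
    exact hσ i
  · rw [key]
    exact hb.signed_injective.comp (Equiv.injective _)
  · rw [key, (Equiv.surjective _).range_comp, hb.range_signed]

/-- Mixing a base array yields many cyclic designs. -/
lemma IsBaseArray.card_le [Fintype ι] [NeZero v] (hb : IsBaseArray K b) (hS : IsShortSystem K S) :
    Nat.card {σ : Perm ι // ∀ i, b (i, 0) + b (i, 1) + b (i, 2) + b (σ i, 3) + b (σ i, 4) = 0} *
      24 ^ Fintype.card ι ≤ Nat.card {B : Set (Block v) // IsCyclicDesign v 5 B} := by
  have h24 : Nat.card {π : Perm (Fin 5) // π 0 = 0} = 24 := by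
    rw [Nat.card_eq_fintype_card]
    decide +kernel
  rw [← h24, ← Nat.card_eq_fintype_card, ← Nat.card_fun, ← Nat.card_prod]
  refine Nat.card_le_card_of_injective (fun p => ⟨designOf (b ∘ mix p.1.1 fun i => (p.2 i).1) S,
    (hb.isDifferenceArray_mix p.1.2 _).isCyclicDesign hS⟩) ?_
  rintro ⟨⟨σ, hσ⟩, π⟩ ⟨⟨σ', hσ'⟩, π'⟩ h
  have hw := hb.isDifferenceArray_mix hσ fun i => (π i).1
  have h0 : ∀ (σ : Perm ι) (π : ι → {π : Perm (Fin 5) // π 0 = 0}) (i : ι),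
      (b ∘ mix σ fun i => (π i).1) (i, 0) = b (i, 0) := by
    intro σ π i
    simp [mix_apply, (π i).2]
  have h1 := row_eq_of_designOf_eq hw (hb.isDifferenceArray_mix hσ' fun i => (π' i).1) hS
    (fun i => by rw [h0, h0]) (congrArg Subtype.val h)
  have hinj : Function.Injective b := by
    intro p q h
    have := @hb.signed_injective (p, true) (q, true) (by simpa [signed] using h)
    simpa using this
  obtain ⟨rfl, h3⟩ := mix_inj (Equiv.ext fun p => hinj (congrFun h1 p))
  have : π = π' := funext fun i => Subtype.ext (congrFun h3 i)
  rw [this]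

/-- A covering array of the right size is a base array. -/
lemma isBaseArray_of_cover [Fintype ι] [NeZero v] (hv : Odd v) (K : Finset (ZMod v)) (hK : 0 ∉ K)
    (hneg : ∀ x ∈ K, -x ∈ K) (hcard : v = 10 * Fintype.card ι + 1 + K.card)
    (hcov : ∀ n : ℕ, 0 < n → 2 * n < v → (n : ZMod v) ∈ K ∨ ∃ p, b p = n ∨ b p = -n) :
    IsBaseArray (K : Set (ZMod v)) b := by
  classical
  have hcov' : ∀ x : ZMod v, x ≠ 0 → x ∉ K → x ∈ Set.range (signed b) := by
    intro x hx hxK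
    have hpos : 0 < x.val := Nat.pos_of_ne_zero (by simpa using hx)
    have hlt := x.val_lt
    have hxv : ((x.val : ℕ) : ZMod v) = x := ZMod.natCast_zmod_val x
    have hxv' : ((v - x.val : ℕ) : ZMod v) = -x := by
      rw [Nat.cast_sub hlt.le, hxv, ZMod.natCast_self, zero_sub]
    obtain ⟨m, hm⟩ := hv
    rcases lt_or_ge (2 * x.val) v with h | h
    · obtain hn | ⟨p, hp | hp⟩ := hcov x.val hpos h
      · exact absurd (hxv ▸ hn) hxK
      · exact ⟨(p, true), by simp [signed, hp]⟩
      · exact ⟨(p, false), by simp [signed, hp]⟩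
    · obtain hn | ⟨p, hp | hp⟩ := hcov (v - x.val) (by omega) (by omega)
      · exact absurd (by simpa [hxv'] using hneg _ hn) hxK
      · exact ⟨(p, false), by simp [signed, hp, hxv']⟩
      · exact ⟨(p, true), by simp [signed, hp, hxv']⟩
  have hT : (Finset.univ \ insert 0 K).card = 10 * Fintype.card ι := by
    rw [Finset.card_sdiff_of_subset (Finset.subset_univ _), Finset.card_insert_of_notMem hK,
      Finset.card_univ, ZMod.card]
    omega
  have hdom : (Finset.univ : Finset ((ι × Fin 5) × Bool)).card = 10 * Fintype.card ι := by
    simp only [Finset.card_univ, Fintype.card_prod, Fintype.card_fin, Fintype.card_bool]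
    ring
  have hsub : Finset.univ \ insert 0 K ⊆ Finset.univ.image (signed b) := by
    intro x hx
    simp only [Finset.mem_sdiff, Finset.mem_univ, true_and, Finset.mem_insert, not_or] at hx
    obtain ⟨p, hp⟩ := hcov' x hx.1 hx.2
    exact Finset.mem_image.2 ⟨p, Finset.mem_univ _, hp⟩
  have hle : (Finset.univ.image (signed b)).card ≤ 10 * Fintype.card ι :=
    hdom ▸ Finset.card_image_le
  have heq := Finset.eq_of_subset_of_card_le hsub (hT ▸ hle)
  refine ⟨?_, ?_⟩
  · have hinj := Finset.card_image_iff.1 ((congrArg Finset.card heq).symm.trans (hT.trans hdom.symm))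
    simpa using hinj
  · ext x
    have := Finset.ext_iff.1 heq x
    simp only [Finset.mem_sdiff, Finset.mem_univ, true_and, Finset.mem_insert, not_or,
      Finset.mem_image] at this
    simpa using this.symm

end Mixing

section Short

variable {v : ℕ}

/-- The closed walk from `z` with five steps `k`, where `5 k = 0`. -/
def shortBlock (k z : ZMod v) : Block v :=
  edgesOf fun j : Fin 5 => (j.val : ZMod v) * k + z

lemma shortBlock_step {k : ZMod v} (hk : 5 * k = 0) (z : ZMod v) (j : Fin 5) :
    ((j + 1 : Fin 5).val : ZMod v) * k + z = ((j.val : ZMod v) * k + z) + k := by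
  fin_cases j <;> simp
  · ring
  · ring
  · ring
  · ring
  · linear_combination -hk

lemma shortBlock_add {k : ZMod v} (hk : 5 * k = 0) (z : ZMod v) :
    shortBlock k (z + k) = shortBlock k z := by
  ext e
  have h : ∀ j : Fin 5,
      (j.val : ZMod v) * k + (z + k) = ((j + 1 : Fin 5).val : ZMod v) * k + z := by
    intro j
    rw [shortBlock_step hk]
    ring
  simp only [shortBlock, mem_edgesOf_five, h]
  exact (Equiv.addRight (1 : Fin 5)).exists_congr_left.trans
    (exists_congr fun i => by simp)

lemma shortBlock_add_mul {k : ZMod v} (hk : 5 * k = 0) (z : ZMod v) (n : ℕ) :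
    shortBlock k (n * k + z) = shortBlock k z := by
  induction n with
  | zero => simp
  | succ n ih =>
    rw [← ih, ← shortBlock_add hk (n * k + z)]
    congr 1
    push_cast
    ring

lemma eq_shortBlock_of_mem {k z a b : ZMod v} (hk : 5 * k = 0) (h : s(a, b) ∈ shortBlock k z) :
    (b - a = k ∨ b - a = -k) ∧ shortBlock k z = shortBlock k a := by
  obtain ⟨j, hj⟩ := mem_edgesOf_five.1 h
  rw [shortBlock_step hk] at hj
  rw [← shortBlock_add_mul hk z j.val]
  rcases Sym2.eq_iff.1 hj with ⟨h1, h2⟩ | ⟨h1, h2⟩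
  · exact ⟨Or.inl (by rw [h2, h1]; ring), by rw [h1]⟩
  · exact ⟨Or.inr (by rw [h2, h1]; ring), by rw [h1, shortBlock_add hk]⟩

lemma isShortSystem_empty : IsShortSystem (∅ : Set (ZMod v)) ∅ :=
  ⟨by simp, by simp, by simp, by simp⟩

variable {q : ℕ}

lemma natCast_mul_eq_zero_iff (hv : v = 5 * q) (hq : 0 < q) (m : ℕ) :
    (m : ZMod v) * (q : ZMod v) = 0 ↔ 5 ∣ m := by
  rw [← Nat.cast_mul, ZMod.natCast_eq_zero_iff, hv]
  exact Nat.mul_dvd_mul_iff_right hq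

/-- The nonzero elements of the subgroup of order five. -/
def shortDiffs (v q : ℕ) : Finset (ZMod v) :=
  {(q : ZMod v), -(q : ZMod v), 2 * (q : ZMod v), -(2 * (q : ZMod v))}

lemma mem_shortDiffs {x : ZMod v} :
    x ∈ shortDiffs v q ↔ ∃ k : ZMod v, (k = q ∨ k = 2 * q) ∧ (x = k ∨ x = -k) := by
  simp only [shortDiffs, Finset.mem_insert, Finset.mem_singleton]
  constructor
  · rintro (h | h | h | h)
    exacts [⟨_, Or.inl rfl, Or.inl h⟩, ⟨_, Or.inl rfl, Or.inr h⟩, ⟨_, Or.inr rfl, Or.inl h⟩,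
      ⟨_, Or.inr rfl, Or.inr h⟩]
  · rintro ⟨k, rfl | rfl, rfl | rfl⟩ <;> simp

/-- The 5-cycles with constant step on the cosets of the subgroup of order five. -/
def shortBlocks (v q : ℕ) : Set (Block v) :=
  {E | ∃ k : ZMod v, (k = q ∨ k = 2 * q) ∧ ∃ z, E = shortBlock k z}

lemma isShortSystem_five (hv : v = 5 * q) (hq : 0 < q) :
    IsShortSystem (shortDiffs v q : Set (ZMod v)) (shortBlocks v q) := by
  have hm := natCast_mul_eq_zero_iff hv hq
  have h5 : ∀ k : ZMod v, (k = q ∨ k = 2 * q) → 5 * k = 0 := by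
    have h := (hm 5).2 (dvd_refl 5)
    have h' := (hm 10).2 (by norm_num)
    push_cast at h h'
    rintro k (rfl | rfl)
    · exact h
    · linear_combination h'
  have h1 := mt (hm 1).1 (by norm_num)
  have h2 := mt (hm 2).1 (by norm_num)
  have h3 := mt (hm 3).1 (by norm_num)
  have h4 := mt (hm 4).1 (by norm_num)
  push_cast at h1 h2 h3 h4
  refine ⟨?_, ?_, ?_, ?_⟩
  · rintro _ ⟨k, hk, z, rfl⟩
    refine ⟨_, ?_, rfl⟩
    intro i j hij
    have hij : (i.val : ZMod v) * k = (j.val : ZMod v) * k := by simpa using hij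
    have key : ∀ m : ℕ, (m : ZMod v) * k = 0 → 5 ∣ m := by
      intro m h
      rcases hk with rfl | rfl
      · exact (hm m).1 h
      · have := (hm (m * 2)).1 (by push_cast; linear_combination h)
        omega
    have h0 : ∀ i j : Fin 5, i ≤ j → (i.val : ZMod v) * k = (j.val : ZMod v) * k → i = j := by
      intro i j hle h
      have := key (j.val - i.val) (by rw [Nat.cast_sub hle, sub_mul, h, sub_self])
      omega
    rcases le_total i j with h | h
    · exact h0 i j h hij
    · exact (h0 j i h hij.symm).symm
  · rintro _ ⟨k, hk, z, rfl⟩ y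
    refine ⟨k, hk, z + y, ?_⟩
    rw [shortBlock, translateBlock_edgesOf, shortBlock]
    simp only [add_assoc]
  · rintro _ ⟨k, hk, z, rfl⟩ a b h
    exact mem_shortDiffs.2 ⟨k, hk, (eq_shortBlock_of_mem (h5 k hk) h).1⟩
  · intro a b hab
    obtain ⟨k, hk, hx⟩ := mem_shortDiffs.1 hab
    refine ⟨shortBlock k a, ⟨⟨k, hk, a, rfl⟩, ?_⟩, ?_⟩
    · have hself : ∀ z, s(z, z + k) ∈ shortBlock k z := fun z =>
        mem_edgesOf_five.2 ⟨0, by simp [add_comm]⟩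
      rcases hx with h | h
      · have := hself a
        rwa [show a + k = b by linear_combination -h] at this
      · have hba : a = b + k := by linear_combination -h
        have := hself b
        rw [← hba, Sym2.eq_swap] at this
        rwa [hba, shortBlock_add (h5 k hk), ← hba]
    · rintro _ ⟨⟨k', hk', z, rfl⟩, he⟩
      obtain ⟨hx', hE⟩ := eq_shortBlock_of_mem (h5 k' hk') he
      rw [hE]
      congr 1
      have hs : k = k' ∨ k = -k' := by
        rcases hx with h | h <;> rcases hx' with h' | h'
        · left; rw [← h, h']
        · right; rw [← h, h']
        · right; linear_combination h - h'
        · left; linear_combination h - h'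
      rcases hk with rfl | rfl <;> rcases hk' with rfl | rfl <;> rcases hs with h | h <;>
        first
        | exact h.symm
        | exact absurd (by linear_combination h) h1
        | exact absurd (by linear_combination h) h2
        | exact absurd (by linear_combination -h) h1
        | exact absurd (by linear_combination h) h3
        | exact absurd (by linear_combination h) h4

lemma card_short (hv : v = 5 * q) (hq : 0 < q) :
    (shortDiffs v q).card = 4 := by
  have hm := natCast_mul_eq_zero_iff hv hq
  have h1 := mt (hm 1).1 (by norm_num)
  have h2 := mt (hm 2).1 (by norm_num)
  have h3 := mt (hm 3).1 (by norm_num)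
  have h4 := mt (hm 4).1 (by norm_num)
  push_cast at h1 h2 h3 h4
  have e1 : (q : ZMod v) ≠ -q := fun h => h2 (by linear_combination h)
  have e2 : (q : ZMod v) ≠ 2 * (q : ZMod v) := fun h => h1 (by linear_combination -h)
  have e3 : (q : ZMod v) ≠ -(2 * (q : ZMod v)) := fun h => h3 (by linear_combination h)
  have e4 : -(q : ZMod v) ≠ 2 * (q : ZMod v) := fun h => h3 (by linear_combination -h)
  have e5 : -(q : ZMod v) ≠ -(2 * (q : ZMod v)) := fun h => h1 (by linear_combination h)
  have e6 : 2 * (q : ZMod v) ≠ -(2 * (q : ZMod v)) := fun h => h4 (by linear_combination h)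
  rw [shortDiffs, Finset.card_insert_of_notMem, Finset.card_insert_of_notMem,
    Finset.card_insert_of_notMem,
    Finset.card_singleton]
  · simpa using e6
  · simp only [Finset.mem_insert, Finset.mem_singleton, not_or]
    exact ⟨e4, e5⟩
  · simp only [Finset.mem_insert, Finset.mem_singleton, not_or]
    exact ⟨e1, e2, e3⟩

end Short

section Arrays

open Equiv

variable {v : ℕ} {ι : Type*} [Fintype ι]

/-- An integer array whose rows split into a triple with sum `-1` and a pair with sum `1`, and
which covers all differences up to sign, yields many cyclic designs. -/
lemma factorial_mul_le_card (hv : Odd v) (K : Finset (ZMod v)) {S : Set (Block v)}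
    (hS : IsShortSystem (K : Set (ZMod v)) S) (hK : 0 ∉ K) (hneg : ∀ x ∈ K, -x ∈ K)
    (hcard : v = 10 * Fintype.card ι + 1 + K.card) (B : ι → Fin 5 → ℤ)
    (htriple : ∀ i, ∃ t : ℤ, B i 0 + B i 1 + B i 2 = -1 + t * v)
    (hpair : ∀ i, B i 3 + B i 4 = 1)
    (hcov : ∀ n : ℕ, 0 < n → 2 * n < v → (n : ZMod v) ∈ K ∨
      ∃ i j, ∃ t : ℤ, B i j = n + t * v ∨ B i j = -n + t * v) :
    (Fintype.card ι).factorial * 24 ^ Fintype.card ι ≤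
      Nat.card {B : Set (Block v) // IsCyclicDesign v 5 B} := by
  classical
  have : NeZero v := ⟨by obtain ⟨m, hm⟩ := hv; omega⟩
  let b : ι × Fin 5 → ZMod v := fun p => (B p.1 p.2 : ℤ)
  have hb : IsBaseArray (K : Set (ZMod v)) b := by
    refine isBaseArray_of_cover hv K hK hneg hcard fun n hn hnv => ?_
    refine (hcov n hn hnv).imp_right ?_
    rintro ⟨i, j, t, h | h⟩
    · exact ⟨(i, j), Or.inl (by simp [b, h])⟩
    · exact ⟨(i, j), Or.inr (by simp [b, h])⟩
  have hσ : ∀ (σ : Perm ι) (i : ι),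
      b (i, 0) + b (i, 1) + b (i, 2) + b (σ i, 3) + b (σ i, 4) = 0 := by
    intro σ i
    obtain ⟨t, ht⟩ := htriple i
    have h1 : b (i, 0) + b (i, 1) + b (i, 2) = -1 := by
      simpa [b] using congrArg (Int.cast : ℤ → ZMod v) ht
    have h2 : b (σ i, 3) + b (σ i, 4) = 1 := by
      simpa [b] using congrArg (Int.cast : ℤ → ZMod v) (hpair (σ i))
    linear_combination h1 + h2
  refine le_of_eq_of_le ?_ (hb.card_le hS)
  rw [Nat.card_congr (Equiv.subtypeUnivEquiv hσ), Nat.card_perm, Nat.card_eq_fintype_card]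

lemma factorial_mul_le_card_zero (hv : Odd v) (hcard : v = 10 * Fintype.card ι + 1)
    (B : ι → Fin 5 → ℤ) (htriple : ∀ i, ∃ t : ℤ, B i 0 + B i 1 + B i 2 = -1 + t * v)
    (hpair : ∀ i, B i 3 + B i 4 = 1)
    (hcov : ∀ n : ℕ, 0 < n → 2 * n < v →
      ∃ i j, ∃ t : ℤ, B i j = n + t * v ∨ B i j = -n + t * v) :
    (Fintype.card ι).factorial * 24 ^ Fintype.card ι ≤
      Nat.card {B : Set (Block v) // IsCyclicDesign v 5 B} :=
  factorial_mul_le_card hv ∅ (S := ∅) (by simpa using isShortSystem_empty) (by simp) (by simp)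
    (by simpa using hcard) B htriple hpair fun n hn hnv => Or.inr (hcov n hn hnv)

lemma factorial_mul_le_card_five (hv : Odd v) {q : ℕ} (hcard : v = 10 * Fintype.card ι + 5)
    (hq : v = 5 * q)
    (B : ι → Fin 5 → ℤ) (htriple : ∀ i, ∃ t : ℤ, B i 0 + B i 1 + B i 2 = -1 + t * v)
    (hpair : ∀ i, B i 3 + B i 4 = 1)
    (hcov : ∀ n : ℕ, 0 < n → 2 * n < v → n = q ∨ n = 2 * q ∨
      ∃ i j, ∃ t : ℤ, B i j = n + t * v ∨ B i j = -n + t * v) :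
    (Fintype.card ι).factorial * 24 ^ Fintype.card ι ≤
      Nat.card {B : Set (Block v) // IsCyclicDesign v 5 B} := by
  have hq0 : 0 < q := by omega
  refine factorial_mul_le_card hv (shortDiffs v q) (isShortSystem_five hq hq0) ?_ ?_
    (by rw [card_short hq hq0]; exact hcard) B htriple hpair fun n hn hnv => ?_
  · rw [mem_shortDiffs]
    have h1 := mt (natCast_mul_eq_zero_iff hq hq0 1).1 (by norm_num)
    have h2 := mt (natCast_mul_eq_zero_iff hq hq0 2).1 (by norm_num)
    push_cast at h1 h2
    rintro ⟨k, rfl | rfl, h | h⟩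
    · exact h1 (by linear_combination -h)
    · exact h1 (by linear_combination h)
    · exact h2 (by linear_combination -h)
    · exact h2 (by linear_combination h)
  · intro x hx
    obtain ⟨k, hk, rfl | rfl⟩ := mem_shortDiffs.1 hx
    · exact mem_shortDiffs.2 ⟨_, hk, Or.inr rfl⟩
    · exact mem_shortDiffs.2 ⟨k, hk, Or.inl (by ring)⟩
  · rcases hcov n hn hnv with rfl | rfl | h
    · exact Or.inl (mem_shortDiffs.2 ⟨_, Or.inl rfl, Or.inl rfl⟩)
    · exact Or.inl (mem_shortDiffs.2 ⟨_, Or.inr rfl, Or.inl (by push_cast; rfl)⟩)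
    · exact Or.inr h

lemma card_designs_twenty_mul_add_one (m : ℕ) :
    (2 * m).factorial * 24 ^ (2 * m) ≤
      Nat.card {B : Set (Block (20 * m + 1)) // IsCyclicDesign (20 * m + 1) 5 B} := by
  let B : Fin m ⊕ Fin m → Fin 5 → ℤ := Sum.elim
    (fun i => ![-(8 * m - i), -(4 * m - i), -(8 * m + 2 + 2 * i), 2 * i + 2, -(2 * i + 1)])
    (fun i => ![-(2 * m + 1 + i), -(6 * m + 1 + i), 8 * m + 1 + 2 * i,
      4 * m + 2 + 2 * i, -(4 * m + 1 + 2 * i)])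
  have hι : Fintype.card (Fin m ⊕ Fin m) = 2 * m := by
    simp
    ring
  rw [← hι]
  refine factorial_mul_le_card_zero ⟨10 * m + 0, by ring⟩ (by rw [hι]; ring) B ?_ ?_ ?_
  · rintro (i | i)
    · exact ⟨-1, by simp [B]; ring⟩
    · exact ⟨0, by simp [B]; ring⟩
  · rintro (i | i) <;> simp [B] <;> ring
  · intro n hn hnv
    by_cases h1 : n ≤ 2 * m ∧ n % 2 = 0
    · exact ⟨Sum.inl ⟨n / 2 - 1, by omega⟩, 3, 0, Or.inl (by simp [B]; omega)⟩
    by_cases h2 : n ≤ 2 * m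
    · exact ⟨Sum.inl ⟨n / 2, by omega⟩, 4, 0, Or.inr (by simp [B]; omega)⟩
    by_cases h3 : n ≤ 3 * m
    · exact ⟨Sum.inr ⟨n - (2 * m + 1), by omega⟩, 0, 0, Or.inr (by simp [B]; omega)⟩
    by_cases h4 : n ≤ 4 * m
    · exact ⟨Sum.inl ⟨4 * m - n, by omega⟩, 1, 0, Or.inr (by simp [B]; omega)⟩
    by_cases h5 : n ≤ 6 * m ∧ n % 2 = 0
    · exact ⟨Sum.inr ⟨n / 2 - 1 - 2 * m, by omega⟩, 3, 0, Or.inl (by simp [B]; omega)⟩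
    by_cases h6 : n ≤ 6 * m
    · exact ⟨Sum.inr ⟨n / 2 - 2 * m, by omega⟩, 4, 0, Or.inr (by simp [B]; omega)⟩
    by_cases h7 : n ≤ 7 * m
    · exact ⟨Sum.inr ⟨n - (6 * m + 1), by omega⟩, 1, 0, Or.inr (by simp [B]; omega)⟩
    by_cases h8 : n ≤ 8 * m
    · exact ⟨Sum.inl ⟨8 * m - n, by omega⟩, 0, 0, Or.inr (by simp [B]; omega)⟩
    by_cases h9 : n % 2 = 0
    · exact ⟨Sum.inl ⟨n / 2 - 1 - 4 * m, by omega⟩, 2, 0, Or.inr (by simp [B]; omega)⟩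
    exact ⟨Sum.inr ⟨n / 2 - 4 * m, by omega⟩, 2, 0, Or.inl (by simp [B]; omega)⟩

lemma card_designs_twenty_mul_add_eleven (m : ℕ) :
    (2 * m + 1).factorial * 24 ^ (2 * m + 1) ≤
      Nat.card {B : Set (Block (20 * m + 11)) // IsCyclicDesign (20 * m + 11) 5 B} := by
  let B : Fin (m + 1) ⊕ Fin m → Fin 5 → ℤ := Sum.elim
    (fun i => ![2 * m + 1 + i, 6 * m + 4 + i, -(8 * m + 6 + 2 * i),
      4 * m + 3 + 2 * i, -(4 * m + 2 + 2 * i)])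
    (fun i => ![8 * m + 4 - i, 4 * m + 1 - i, 8 * m + 5 + 2 * i, 2 * i + 2, -(2 * i + 1)])
  have hι : Fintype.card (Fin (m + 1) ⊕ Fin m) = 2 * m + 1 := by
    simp
    ring
  rw [← hι]
  refine factorial_mul_le_card_zero ⟨10 * m + 5, by ring⟩ (by rw [hι]; ring) B ?_ ?_ ?_
  · rintro (i | i)
    · exact ⟨0, by simp [B]; ring⟩
    · exact ⟨1, by simp [B]; ring⟩
  · rintro (i | i) <;> simp [B] <;> ring
  · intro n hn hnv
    by_cases h1 : n ≤ 2 * m ∧ n % 2 = 0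
    · exact ⟨Sum.inr ⟨n / 2 - 1, by omega⟩, 3, 0, Or.inl (by simp [B]; omega)⟩
    by_cases h2 : n ≤ 2 * m
    · exact ⟨Sum.inr ⟨n / 2, by omega⟩, 4, 0, Or.inr (by simp [B]; omega)⟩
    by_cases h3 : n ≤ 3 * m + 1
    · exact ⟨Sum.inl ⟨n - (2 * m + 1), by omega⟩, 0, 0, Or.inl (by simp [B]; omega)⟩
    by_cases h4 : n ≤ 4 * m + 1
    · exact ⟨Sum.inr ⟨4 * m + 1 - n, by omega⟩, 1, 0, Or.inl (by simp [B]; omega)⟩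
    by_cases h5 : n ≤ 6 * m + 3 ∧ n % 2 = 0
    · exact ⟨Sum.inl ⟨n / 2 - 1 - 2 * m, by omega⟩, 4, 0, Or.inr (by simp [B]; omega)⟩
    by_cases h6 : n ≤ 6 * m + 3
    · exact ⟨Sum.inl ⟨n / 2 - 1 - 2 * m, by omega⟩, 3, 0, Or.inl (by simp [B]; omega)⟩
    by_cases h7 : n ≤ 7 * m + 4
    · exact ⟨Sum.inl ⟨n - (6 * m + 4), by omega⟩, 1, 0, Or.inl (by simp [B]; omega)⟩
    by_cases h8 : n ≤ 8 * m + 4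
    · exact ⟨Sum.inr ⟨8 * m + 4 - n, by omega⟩, 0, 0, Or.inl (by simp [B]; omega)⟩
    by_cases h9 : n = 10 * m + 5
    · exact ⟨Sum.inl ⟨m, by omega⟩, 2, -1, Or.inl (by simp [B]; omega)⟩
    by_cases h10 : n % 2 = 0
    · exact ⟨Sum.inl ⟨n / 2 - 3 - 4 * m, by omega⟩, 2, 0, Or.inr (by simp [B]; omega)⟩
    exact ⟨Sum.inr ⟨n / 2 - 2 - 4 * m, by omega⟩, 2, 0, Or.inl (by simp [B]; omega)⟩

lemma card_designs_twenty_mul_add_five (m : ℕ) :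
    (2 * m).factorial * 24 ^ (2 * m) ≤
      Nat.card {B : Set (Block (20 * m + 5)) // IsCyclicDesign (20 * m + 5) 5 B} := by
  let B : Fin m ⊕ Fin m → Fin 5 → ℤ := Sum.elim
    (fun i => ![3 * m + 1 + i, 7 * m + 2 + i, -(10 * m + 4 + 2 * i), 2 * i + 2, -(2 * i + 1)])
    (fun i => ![7 * m + 1 - i, 3 * m - i, 10 * m + 3 + 2 * i,
      4 * m + 3 + 2 * i, -(4 * m + 2 + 2 * i)])
  have hι : Fintype.card (Fin m ⊕ Fin m) = 2 * m := by
    simp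
    ring
  rw [← hι]
  refine factorial_mul_le_card_five ⟨10 * m + 2, by ring⟩ (q := 4 * m + 1)
    (by rw [hι]; ring) (by ring) B ?_ ?_ ?_
  · rintro (i | i)
    · exact ⟨0, by simp [B]; ring⟩
    · exact ⟨1, by simp [B]; ring⟩
  · rintro (i | i) <;> simp [B] <;> ring
  · intro n hn hnv
    by_cases hq : n = 4 * m + 1 ∨ n = 2 * (4 * m + 1)
    · tauto
    refine Or.inr (Or.inr ?_)
    by_cases h1 : n ≤ 2 * m ∧ n % 2 = 0
    · exact ⟨Sum.inl ⟨n / 2 - 1, by omega⟩, 3, 0, Or.inl (by simp [B]; omega)⟩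
    by_cases h2 : n ≤ 2 * m
    · exact ⟨Sum.inl ⟨n / 2, by omega⟩, 4, 0, Or.inr (by simp [B]; omega)⟩
    by_cases h3 : n ≤ 3 * m
    · exact ⟨Sum.inr ⟨3 * m - n, by omega⟩, 1, 0, Or.inl (by simp [B]; omega)⟩
    by_cases h4 : n ≤ 4 * m
    · exact ⟨Sum.inl ⟨n - (3 * m + 1), by omega⟩, 0, 0, Or.inl (by simp [B]; omega)⟩
    by_cases h5 : n ≤ 6 * m + 1 ∧ n % 2 = 0
    · exact ⟨Sum.inr ⟨n / 2 - 1 - 2 * m, by omega⟩, 4, 0, Or.inr (by simp [B]; omega)⟩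
    by_cases h6 : n ≤ 6 * m + 1
    · exact ⟨Sum.inr ⟨n / 2 - 1 - 2 * m, by omega⟩, 3, 0, Or.inl (by simp [B]; omega)⟩
    by_cases h7 : n ≤ 7 * m + 1
    · exact ⟨Sum.inr ⟨7 * m + 1 - n, by omega⟩, 0, 0, Or.inl (by simp [B]; omega)⟩
    by_cases h8 : n ≤ 8 * m + 1
    · exact ⟨Sum.inl ⟨n - (7 * m + 2), by omega⟩, 1, 0, Or.inl (by simp [B]; omega)⟩
    by_cases h9 : n % 2 = 0
    · exact ⟨Sum.inr ⟨(10 * m + 2 - n) / 2, by omega⟩, 2, 1, Or.inr (by simp [B]; omega)⟩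
    exact ⟨Sum.inl ⟨(10 * m + 1 - n) / 2, by omega⟩, 2, -1, Or.inl (by simp [B]; omega)⟩

lemma card_designs_twenty_mul_add_fifteen (m : ℕ) :
    (2 * m + 1).factorial * 24 ^ (2 * m + 1) ≤
      Nat.card {B : Set (Block (20 * m + 15)) // IsCyclicDesign (20 * m + 15) 5 B} := by
  let B : (Fin m ⊕ Fin m) ⊕ Unit → Fin 5 → ℤ := Sum.elim (Sum.elim
    (fun i => ![8 * m + 5 - i, 4 * m + 2 - i, 8 * m + 7 + 2 * i, 2 * i + 4, -(2 * i + 3)])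
    (fun i => ![2 * m + 3 + i, 6 * m + 6 + i, -(8 * m + 10 + 2 * i),
      4 * m + 7 + 2 * i, -(4 * m + 6 + 2 * i)]))
    (fun _ => ![8 * m + 8, -(4 * m + 4), -(4 * m + 5), 2, -1])
  have hι : Fintype.card ((Fin m ⊕ Fin m) ⊕ Unit) = 2 * m + 1 := by
    simp
    ring
  rw [← hι]
  refine factorial_mul_le_card_five ⟨10 * m + 7, by ring⟩ (q := 4 * m + 3)
    (by rw [hι]; ring) (by ring) B ?_ ?_ ?_
  · rintro ((i | i) | i)
    · exact ⟨1, by simp [B]; ring⟩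
    · exact ⟨0, by simp [B]; ring⟩
    · exact ⟨0, by simp [B]; ring⟩
  · rintro ((i | i) | i) <;> simp [B] <;> ring
  · intro n hn hnv
    by_cases hq : n = 4 * m + 3 ∨ n = 2 * (4 * m + 3)
    · tauto
    refine Or.inr (Or.inr ?_)
    by_cases h1 : n = 1
    · exact ⟨Sum.inr (), 4, 0, Or.inr (by simp [B]; omega)⟩
    by_cases h2 : n = 2
    · exact ⟨Sum.inr (), 3, 0, Or.inl (by simp [B]; omega)⟩
    by_cases h3 : n ≤ 2 * m + 2 ∧ n % 2 = 0
    · exact ⟨Sum.inl (Sum.inl ⟨n / 2 - 2, by omega⟩), 3, 0, Or.inl (by simp [B]; omega)⟩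
    by_cases h4 : n ≤ 2 * m + 2
    · exact ⟨Sum.inl (Sum.inl ⟨n / 2 - 1, by omega⟩), 4, 0, Or.inr (by simp [B]; omega)⟩
    by_cases h5 : n ≤ 3 * m + 2
    · exact ⟨Sum.inl (Sum.inr ⟨n - (2 * m + 3), by omega⟩), 0, 0, Or.inl (by simp [B]; omega)⟩
    by_cases h6 : n ≤ 4 * m + 2
    · exact ⟨Sum.inl (Sum.inl ⟨4 * m + 2 - n, by omega⟩), 1, 0, Or.inl (by simp [B]; omega)⟩
    by_cases h7 : n = 4 * m + 4
    · exact ⟨Sum.inr (), 1, 0, Or.inr (by simp [B]; omega)⟩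
    by_cases h8 : n = 4 * m + 5
    · exact ⟨Sum.inr (), 2, 0, Or.inr (by simp [B]; omega)⟩
    by_cases h9 : n ≤ 6 * m + 5 ∧ n % 2 = 0
    · exact ⟨Sum.inl (Sum.inr ⟨n / 2 - 3 - 2 * m, by omega⟩), 4, 0, Or.inr (by simp [B]; omega)⟩
    by_cases h10 : n ≤ 6 * m + 5
    · exact ⟨Sum.inl (Sum.inr ⟨n / 2 - 3 - 2 * m, by omega⟩), 3, 0, Or.inl (by simp [B]; omega)⟩
    by_cases h11 : n ≤ 7 * m + 5
    · exact ⟨Sum.inl (Sum.inr ⟨n - (6 * m + 6), by omega⟩), 1, 0, Or.inl (by simp [B]; omega)⟩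
    by_cases h12 : n ≤ 8 * m + 5
    · exact ⟨Sum.inl (Sum.inl ⟨8 * m + 5 - n, by omega⟩), 0, 0, Or.inl (by simp [B]; omega)⟩
    by_cases h13 : n = 8 * m + 8
    · exact ⟨Sum.inr (), 0, 0, Or.inl (by simp [B]; omega)⟩
    by_cases h14 : m = 0
    · exact ⟨Sum.inr (), 0, 1, Or.inr (by simp [B]; omega)⟩
    by_cases h15 : n = 10 * m + 7
    · exact ⟨Sum.inl (Sum.inr ⟨m - 1, by omega⟩), 2, -1, Or.inl (by simp [B]; omega)⟩
    by_cases h16 : n % 2 = 0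
    · exact ⟨Sum.inl (Sum.inr ⟨n / 2 - 5 - 4 * m, by omega⟩), 2, 0, Or.inr (by simp [B]; omega)⟩
    exact ⟨Sum.inl (Sum.inl ⟨n / 2 - 3 - 4 * m, by omega⟩), 2, 0, Or.inl (by simp [B]; omega)⟩

lemma factorial_mul_le_card_designs {v s : ℕ} (hv : v = 10 * s + 1 ∨ v = 10 * s + 5) :
    s.factorial * 24 ^ s ≤ Nat.card {B : Set (Block v) // IsCyclicDesign v 5 B} := by
  obtain ⟨m, rfl | rfl⟩ := s.even_or_odd'
  · rcases hv with rfl | rfl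
    · rw [show 10 * (2 * m) + 1 = 20 * m + 1 by ring]
      exact card_designs_twenty_mul_add_one m
    · rw [show 10 * (2 * m) + 5 = 20 * m + 5 by ring]
      exact card_designs_twenty_mul_add_five m
  · rcases hv with rfl | rfl
    · rw [show 10 * (2 * m + 1) + 1 = 20 * m + 11 by ring]
      exact card_designs_twenty_mul_add_eleven m
    · rw [show 10 * (2 * m + 1) + 5 = 20 * m + 15 by ring]
      exact card_designs_twenty_mul_add_fifteen m

lemma sub_one_le_factorial_mul_totient {v s : ℕ} (hs : 1 ≤ s)
    (hv : v = 10 * s + 1 ∨ v = 10 * s + 5) (hv15 : v ≠ 15) :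
    v - 1 ≤ s.factorial * v.totient := by
  by_cases h5 : s < 5
  · rcases hv with rfl | rfl <;> interval_cases s <;> first | omega | decide +kernel
  · have hφ : 0 < v.totient := Nat.totient_pos.2 (by omega)
    have h : ∀ n, 5 ≤ n → 10 * n + 4 ≤ n.factorial := by
      intro n hn
      induction n, hn using Nat.le_induction with
      | base => decide
      | succ n hn ih =>
        rw [Nat.factorial_succ]
        nlinarith
    calc v - 1 ≤ s.factorial * 1 := by have := h s (by omega); omega
      _ ≤ _ := Nat.mul_le_mul_left _ hφ

end Arrays

section Fifteen

variable {v : ℕ}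

/-- The vertex sets of the cycles of a design. -/
def vertexSets (B : Set (Block v)) : Set (Set (ZMod v)) :=
  (fun E : Block v => {x | ∃ e ∈ E, x ∈ e}) '' B

lemma vertexSets_image (f : ZMod v ≃ ZMod v) (B : Set (Block v)) :
    vertexSets ((fun E : Block v => E.image (Sym2.map f)) '' B) =
      (fun s => f '' s) '' vertexSets B := by
  simp only [vertexSets, Set.image_image]
  refine Set.image_congr fun E _ => ?_
  ext x
  simp only [Finset.mem_image, Set.mem_ofPred_eq, Set.mem_image]
  constructor
  · rintro ⟨_, ⟨e, he, rfl⟩, hx⟩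
    obtain ⟨y, hy, rfl⟩ := Sym2.mem_map.1 hx
    exact ⟨y, ⟨e, he, hy⟩, rfl⟩
  · rintro ⟨y, ⟨e, he, hy⟩, rfl⟩
    exact ⟨_, ⟨e, he, rfl⟩, Sym2.mem_map.2 ⟨y, hy, rfl⟩⟩

/-- Some two members have exactly three common elements. -/
def HasTripleMeet {α : Type*} (𝒱 : Set (Set α)) : Prop :=
  ∃ s ∈ 𝒱, ∃ t ∈ 𝒱, (s ∩ t).ncard = 3

/-- Some two disjoint members are not both disjoint from a third one. -/
def HasMaximalDisjointPair {α : Type*} (𝒱 : Set (Set α)) : Prop :=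
  ∃ s ∈ 𝒱, ∃ t ∈ 𝒱, Disjoint s t ∧ ∀ u ∈ 𝒱, ¬(Disjoint u s ∧ Disjoint u t)

lemma hasTripleMeet_image {α : Type*} (f : α ≃ α) (𝒱 : Set (Set α)) :
    HasTripleMeet ((fun s => f '' s) '' 𝒱) ↔ HasTripleMeet 𝒱 := by
  simp only [HasTripleMeet, Set.exists_mem_image, ← Set.image_inter f.injective,
    Set.ncard_image_of_injective _ f.injective]

lemma hasMaximalDisjointPair_image {α : Type*} (f : α ≃ α) (𝒱 : Set (Set α)) :
    HasMaximalDisjointPair ((fun s => f '' s) '' 𝒱) ↔ HasMaximalDisjointPair 𝒱 := by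
  simp only [HasMaximalDisjointPair, Set.exists_mem_image, Set.forall_mem_image,
    Set.disjoint_image_iff f.injective]

lemma vertexSet_edgesOf (c : Fin 5 → ZMod v) :
    {x | ∃ e ∈ edgesOf c, x ∈ e} = (Finset.univ.image c : Finset (ZMod v)) := by
  ext x
  simp only [mem_edgesOf_five, Set.mem_ofPred_eq, Finset.coe_image, Finset.coe_univ, Set.image_univ,
    Set.mem_range]
  constructor
  · rintro ⟨e, ⟨i, rfl⟩, hx⟩
    rcases Sym2.mem_iff.1 hx with rfl | rfl
    · exact ⟨i, rfl⟩
    · exact ⟨i + 1, rfl⟩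
  · rintro ⟨i, rfl⟩
    exact ⟨_, ⟨i, rfl⟩, Sym2.mem_mk_left _ _⟩

/-- The vertex sets of the design on 15 points generated by the walk with steps `d` and the
5-cycles of constant step `3` or `6`. -/
def fifteenVertices (d : Fin 5 → ZMod 15) (p : Fin 3 × ZMod 15) : Finset (ZMod 15) :=
  Finset.univ.image fun j : Fin 5 => ![walk d j, (j.val : ZMod 15) * 3, j.val * 6] p.1 + p.2

lemma vertexSets_designOf_fifteen (d : Fin 5 → ZMod 15) :
    vertexSets (designOf (fun p : Unit × Fin 5 => d p.2) (shortBlocks 15 3)) =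
      Set.range fun p => (fifteenVertices d p : Set (ZMod 15)) := by
  ext s
  simp only [vertexSets, Set.mem_image, Set.mem_range, Prod.exists, Fin.exists_fin_succ]
  constructor
  · rintro ⟨E, ⟨i, z, rfl⟩ | ⟨k, rfl | rfl, z, rfl⟩, rfl⟩
    · exact Or.inl ⟨z, (vertexSet_edgesOf _).symm⟩
    · exact Or.inr (Or.inl ⟨z, (vertexSet_edgesOf _).symm⟩)
    · refine Or.inr (Or.inr (Or.inl ⟨z, (vertexSet_edgesOf _).symm⟩))
  · rintro (⟨z, rfl⟩ | ⟨z, rfl⟩ | ⟨z, rfl⟩ | ⟨i, _⟩)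
    · exact ⟨_, Or.inl ⟨(), z, rfl⟩, vertexSet_edgesOf _⟩
    · exact ⟨_, Or.inr ⟨_, Or.inl rfl, z, rfl⟩, vertexSet_edgesOf _⟩
    · exact ⟨_, Or.inr ⟨_, Or.inr rfl, z, rfl⟩, vertexSet_edgesOf _⟩
    · exact i.elim0

lemma hasTripleMeet_fifteen (d : Fin 5 → ZMod 15) :
    HasTripleMeet (vertexSets (designOf (fun p : Unit × Fin 5 => d p.2) (shortBlocks 15 3))) ↔
      ∃ p q, (fifteenVertices d p ∩ fifteenVertices d q).card = 3 := by
  simp only [HasTripleMeet, vertexSets_designOf_fifteen, Set.exists_range_iff, ← Finset.coe_inter,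
    Set.ncard_coe_finset]

lemma hasMaximalDisjointPair_fifteen (d : Fin 5 → ZMod 15) :
    HasMaximalDisjointPair
        (vertexSets (designOf (fun p : Unit × Fin 5 => d p.2) (shortBlocks 15 3))) ↔
      ∃ p q, Disjoint (fifteenVertices d p) (fifteenVertices d q) ∧
        ∀ r, ¬(Disjoint (fifteenVertices d r) (fifteenVertices d p) ∧
          Disjoint (fifteenVertices d r) (fifteenVertices d q)) := by
  simp only [HasMaximalDisjointPair, vertexSets_designOf_fifteen, Set.exists_range_iff,
    Set.forall_mem_range, Finset.disjoint_coe]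

/-- Three base walks for cyclic designs on 15 points. -/
def fifteenSteps : Fin 3 → Fin 5 → ZMod 15 :=
  ![![1, -2, 4, 5, 7], ![1, -2, 5, 7, 4], ![1, -2, 7, 5, 4]]

lemma isDifferenceArray_fifteen (a : Fin 3) :
    IsDifferenceArray (shortDiffs 15 3 : Set (ZMod 15))
      (fun p : Unit × Fin 5 => fifteenSteps a p.2) := by
  refine ⟨?_, ?_, ?_⟩
  · revert a
    decide
  · revert a
    unfold Function.Injective
    decide +kernel
  · ext x
    simp only [Set.mem_range, Set.mem_ofPred_eq, Finset.mem_coe]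
    revert a x
    decide +kernel

lemma three_le_NC_fifteen : 3 ≤ NC 15 5 := by
  let D (a : Fin 3) : {B : Set (Block 15) // IsCyclicDesign 15 5 B} :=
    ⟨_, (isDifferenceArray_fifteen a).isCyclicDesign
      (isShortSystem_five (v := 15) (q := 3) rfl (by norm_num))⟩
  let r (B B' : {B : Set (Block 15) // IsCyclicDesign 15 5 B}) : Prop := Isomorphic B.1 B'.1
  let P : Quot r → Prop × Prop :=
    Quot.lift (fun B => (HasTripleMeet (vertexSets B.1), HasMaximalDisjointPair (vertexSets B.1)))
      (by
        rintro ⟨B, hB⟩ ⟨B', hB'⟩ ⟨f, rfl⟩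
        simp only [vertexSets_image, hasTripleMeet_image, hasMaximalDisjointPair_image])
  have htriple : ∀ a, (P (Quot.mk r (D a))).1 ↔ a = 2 := by
    intro a
    refine (hasTripleMeet_fifteen _).trans ?_
    revert a
    decide +kernel
  have hzero : ¬(P (Quot.mk r (D 0))).2 := by
    refine mt (hasMaximalDisjointPair_fifteen _).1 ?_
    decide +kernel
  have hone : (P (Quot.mk r (D 1))).2 := by
    refine (hasMaximalDisjointPair_fifteen _).2 ?_
    decide +kernel
  have hinj : Function.Injective fun a => Quot.mk r (D a) := by
    intro a b h
    have h : P (Quot.mk r (D a)) = P (Quot.mk r (D b)) := congrArg P h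
    have h1 := htriple a
    rw [h, htriple b] at h1
    have h01 : P (Quot.mk r (D 0)) ≠ P (Quot.mk r (D 1)) := fun h => hzero (by rw [h]; exact hone)
    fin_cases a <;> fin_cases b
    · rfl
    · exact absurd h h01
    · simp at h1
    · exact absurd h.symm h01
    · rfl
    · simp at h1
    · simp at h1
    · simp at h1
    · rfl
  rw [NC, ← Nat.card_fin 3]
  exact Nat.card_le_card_of_injective _ hinj

end Fifteen

end CCS

/-- If `F = {C_1, …, C_n}` is a `(K_v, C_5)`-difference system and
`s` (with `1 ≤ s ≤ n`) is the number of cycles of `F` of type 1, then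
`NC(v,5) ≥ ⌈24^s / φ(v)⌉`. -/
theorem stmt6 (v : ℕ) (hv : 3 ≤ v) (hvodd : Odd v)
    (F : Finset (CCS.Block v)) (hF : CCS.IsDifferenceSystem v 5 F)
    (s : ℕ) (hs : s = (F.filter fun E => CCS.cycleType E = 1).card)
    (hs1 : 1 ≤ s) (hsn : s ≤ F.card) :
    (⌈(24 ^ s : ℚ) / (v.totient : ℚ)⌉ : ℤ) ≤ (CCS.NC v 5 : ℤ) := by
  have h1v : Fact (1 < v) := ⟨by omega⟩
  have hφ : (0 : ℚ) < v.totient := by exact_mod_cast Nat.totient_pos.2 (by omega)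
  have hvs := CCS.order_of_differenceSystem hv hvodd hF
  rw [← hs] at hvs
  rw [Int.ceil_le, div_le_iff₀ hφ]
  norm_cast
  by_cases hv15 : v = 15
  · subst hv15
    obtain rfl : s = 1 := by omega
    have h3 := CCS.three_le_NC_fifteen
    have hφ15 : Nat.totient 15 = 8 := by decide +kernel
    rw [hφ15]
    omega
  · have hcard := CCS.factorial_mul_le_card_designs hvs
    refine Nat.le_of_mul_le_mul_left ?_ s.factorial_pos
    calc s.factorial * 24 ^ s ≤ CCS.NC v 5 * (v - 1) := hcard.trans CCS.card_cyclicDesign_le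
      _ ≤ CCS.NC v 5 * (s.factorial * v.totient) :=
        Nat.mul_le_mul_left _ (CCS.sub_one_le_factorial_mul_totient hs1 hvs hv15)
      _ = s.factorial * (CCS.NC v 5 * v.totient) := by ring
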